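/- Let $T>0$ and $H\in(\tfrac23,1)$. Then $\lim_{\varepsilon\to0^+}\varepsilon^{3-\frac2H}\, V_3^{(1)}(\varepsilon) = \sigma^2$, where $V_3^{(1)}(\varepsilon) := \frac1\pi\int_{\mathcal{S}_3} \big(\varepsilon+(t_1-s_1)^{2H}\big)^{-3/2}\big(\varepsilon+(t_2-s_2)^{2H}\big)^{-3/2}\,\mu_H(s_2-s_1,\,t_1-s_1,\,t_2-s_2)\; ds_1\, ds_2\, dt_1\, dt_2$ and $\sigma^2 := \frac{T^{2H}(2H-1)}{4H\pi}\, B\big(\tfrac1H,\tfrac{3H-2}{2H}\big)^2\, B(2,2H-1)$, with $B(\cdot,\cdot)$ the Beta function. -/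

import Mathlib

open Real Set MeasureTheory Filter

/-- The covariance `𝔼[B_{u₁}(B_{x+u₂} - B_x)]` of a fractional Brownian motion of
Hurst parameter `H`. -/
noncomputable def mu (H x u₁ u₂ : ℝ) : ℝ :=
  (1/2) * ((x + u₂) ^ (2*H) - x ^ (2*H) - |x + u₂ - u₁| ^ (2*H) + |x - u₁| ^ (2*H))

/-- The Euler Beta function `B(p,q) = ∫₀¹ x^{p-1}(1-x)^{q-1} dx`. -/
noncomputable def betaFn (p q : ℝ) : ℝ := ∫ x in (0:ℝ)..1, x ^ (p - 1) * (1 - x) ^ (q - 1)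

/-- The region `𝒮₃ = {(s₁,s₂,t₁,t₂) ∈ [0,T]⁴ : s₁ ≤ t₁ ≤ s₂ ≤ t₂}`. -/
def regS3 (T : ℝ) : Set (ℝ × ℝ × ℝ × ℝ) :=
  {p | p.1 ∈ Icc (0:ℝ) T ∧ p.2.1 ∈ Icc (0:ℝ) T ∧ p.2.2.1 ∈ Icc (0:ℝ) T ∧
    p.2.2.2 ∈ Icc (0:ℝ) T ∧ p.1 ≤ p.2.2.1 ∧ p.2.2.1 ≤ p.2.1 ∧ p.2.1 ≤ p.2.2.2}

/-- `V₃⁽¹⁾(ε)`, the contribution of the region `𝒮₃` to the variance of the first Wiener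
chaos component of the approximating derivative of self-intersection local time. -/
noncomputable def V3one (H T ε : ℝ) : ℝ :=
  (1/π) * ∫ p in regS3 T,
    (ε + (p.2.2.1 - p.1) ^ (2*H)) ^ (-(3/2 : ℝ)) *
      (ε + (p.2.2.2 - p.2.1) ^ (2*H)) ^ (-(3/2 : ℝ)) *
      mu H (p.2.1 - p.1) (p.2.2.1 - p.1) (p.2.2.2 - p.2.1)

lemma exists_second_difference_rpow {p y a b : ℝ} (hy : 0 < y) (ha : 0 ≤ a) (hb : 0 ≤ b) :
    ∃ η ∈ Icc y (y + a + b), (y + a + b) ^ p - (y + a) ^ p - (y + b) ^ p + y ^ p =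
      p * (p - 1) * (a * b) * η ^ (p - 2) := by
  rcases ha.eq_or_lt with rfl | ha
  · exact ⟨y, ⟨le_rfl, by linarith⟩, by simp⟩
  rcases hb.eq_or_lt with rfl | hb
  · exact ⟨y, ⟨le_rfl, by linarith⟩, by simp⟩
  have hd : ∀ t : ℝ, 0 < t → ∀ r : ℝ, HasDerivAt (fun t : ℝ => t ^ r) (r * t ^ (r - 1)) t :=
    fun t ht r => Real.hasDerivAt_rpow_const (Or.inl ht.ne')
  have hd1 : ∀ t : ℝ, 0 < t → HasDerivAt (fun t : ℝ => (t + b) ^ p - t ^ p)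
      (p * (t + b) ^ (p - 1) - p * t ^ (p - 1)) t := fun t ht =>
    ((hd (t + b) (by linarith) p).comp_add_const t b).sub (hd t ht p)
  obtain ⟨ξ, ⟨hξ1, hξ2⟩, hξ⟩ := exists_hasDerivAt_eq_slope
    (fun t : ℝ => (t + b) ^ p - t ^ p) (fun t => p * (t + b) ^ (p - 1) - p * t ^ (p - 1))
    (show y < y + a by linarith)
    (fun t ht => (hd1 t (hy.trans_le ht.1)).continuousAt.continuousWithinAt)
    (fun t ht => hd1 t (hy.trans ht.1))
  have hξ0 : 0 < ξ := hy.trans hξ1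
  obtain ⟨η, ⟨hη1, hη2⟩, hη⟩ := exists_hasDerivAt_eq_slope
    (fun t : ℝ => t ^ (p - 1)) (fun t => (p - 1) * t ^ (p - 1 - 1))
    (show ξ < ξ + b by linarith)
    (fun t ht => (hd t (hξ0.trans_le ht.1) _).continuousAt.continuousWithinAt)
    (fun t ht => hd t (hξ0.trans ht.1) _)
  refine ⟨η, ⟨by linarith, by linarith⟩, ?_⟩
  rw [eq_div_iff (by linarith)] at hξ hη
  rw [show p - 1 - 1 = p - 2 by ring] at hη
  linear_combination -hξ - p * a * hη

lemma measurePreserving_gaps : MeasurePreserving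
    (fun q : ℝ × ℝ × ℝ × ℝ =>
      (q.1, q.1 + (q.2.2.1 + q.2.1), q.1 + q.2.2.1, q.1 + (q.2.2.1 + q.2.1 + q.2.2.2))) := by
  have hA : MeasurePreserving (fun q : ℝ × ℝ × ℝ => (q.1, q.2.1, q.1 + q.2.2)) := by
    refine (MeasurePreserving.id volume).skew_product
      (g := fun x (q : ℝ × ℝ) => (q.1, x + q.2)) (by fun_prop) (ae_of_all _ fun x => ?_)
    exact ((MeasurePreserving.id volume).prod (measurePreserving_add_left volume x)).map_eq
  have hB' : MeasurePreserving (fun q : (ℝ × ℝ) × ℝ => (q.1, q.1.1 + q.2)) := by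
    refine (MeasurePreserving.id volume).skew_product
      (g := fun (x : ℝ × ℝ) (y : ℝ) => x.1 + y) (by fun_prop) (ae_of_all _ fun x => ?_)
    exact (measurePreserving_add_left volume x.1).map_eq
  have hB : MeasurePreserving (fun q : ℝ × ℝ × ℝ => (q.2.1 + q.1, q.2)) :=
    Measure.measurePreserving_swap.comp (hB'.comp Measure.measurePreserving_swap)
  refine (MeasurePreserving.id volume).skew_product
    (g := fun s (q : ℝ × ℝ × ℝ) => (s + (q.2.1 + q.1), s + q.2.1, s + (q.2.1 + q.1 + q.2.2)))
    (by fun_prop) (ae_of_all _ fun s => ?_)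
  have hs := measurePreserving_add_left (volume : Measure ℝ) s
  exact ((hs.prod (hs.prod hs)).comp (hA.comp hB)).map_eq

lemma measurePreserving_scale {c : ℝ} (hc : 0 < c) : MeasurePreserving
    (fun q : ℝ × ℝ × ℝ × ℝ => (q.1, q.2.1, c * q.2.2.1, c * q.2.2.2))
    (ENNReal.ofReal (c ^ 2) • volume) := by
  have h1 : MeasurePreserving (fun x : ℝ => c * x) (ENNReal.ofReal c • volume) volume :=
    ⟨by fun_prop, by
      rw [Measure.map_smul, Real.map_volume_mul_left hc.ne', abs_of_pos (by positivity),
        smul_smul, ← ENNReal.ofReal_mul hc.le, mul_inv_cancel₀ hc.ne', ENNReal.ofReal_one, one_smul]⟩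
  have h2 := (MeasurePreserving.id (volume : Measure ℝ)).prod
    ((MeasurePreserving.id (volume : Measure ℝ)).prod (h1.prod h1))
  simp only [Measure.prod_smul_left, Measure.prod_smul_right, smul_smul] at h2
  rw [← ENNReal.ofReal_mul hc.le, ← sq] at h2
  exact h2

lemma integral_gaps {c : ℝ} (hc : 0 < c) (F : ℝ × ℝ × ℝ × ℝ → ℝ) :
    ∫ q, F q = c ^ 2 * ∫ q : ℝ × ℝ × ℝ × ℝ, F (q.1, q.1 + (c * q.2.2.1 + q.2.1),
      q.1 + c * q.2.2.1, q.1 + (c * q.2.2.1 + q.2.1 + c * q.2.2.2)) := by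
  have h := measurePreserving_gaps.comp (measurePreserving_scale hc)
  have he : MeasurableEmbedding ((fun q : ℝ × ℝ × ℝ × ℝ =>
      (q.1, q.1 + (q.2.2.1 + q.2.1), q.1 + q.2.2.1, q.1 + (q.2.2.1 + q.2.1 + q.2.2.2))) ∘
      (fun q : ℝ × ℝ × ℝ × ℝ => (q.1, q.2.1, c * q.2.2.1, c * q.2.2.2))) := by
    refine Continuous.measurableEmbedding (by fun_prop) ?_
    rintro ⟨s, y, a, b⟩ ⟨s', y', a', b'⟩ h
    simp only [Function.comp, Prod.mk.injEq] at h ⊢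
    obtain ⟨rfl, h2, h3, h4⟩ := h
    have : a = a' := mul_left_cancel₀ hc.ne' (by linarith)
    subst this
    have : b = b' := mul_left_cancel₀ hc.ne' (by linarith)
    subst this
    exact ⟨rfl, by linarith, rfl, rfl⟩
  rw [← h.integral_comp he, integral_smul_measure, ENNReal.toReal_ofReal (by positivity),
    smul_eq_mul]
  rfl

lemma indicator_kernel_nonneg (p x : ℝ) :
    0 ≤ (Ioi 0).indicator (fun x : ℝ => x * (1 + x ^ p) ^ (-(3/2 : ℝ))) x := by
  refine indicator_nonneg (fun x hx => ?_) x
  have hx : 0 < x := hx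
  positivity

lemma integrable_kernel {p : ℝ} (hp : 4 / 3 < p) :
    IntegrableOn (fun x : ℝ => x * (1 + x ^ p) ^ (-(3/2 : ℝ))) (Ioi 0) := by
  have hm : Measurable fun x : ℝ => x * (1 + x ^ p) ^ (-(3/2 : ℝ)) := by fun_prop
  rw [← Ioc_union_Ioi_eq_Ioi zero_le_one, integrableOn_union]
  constructor
  · refine Integrable.mono' (integrableOn_const (C := (1:ℝ)) (by simp)) hm.aestronglyMeasurable ?_
    refine (ae_restrict_iff' measurableSet_Ioc).2 (ae_of_all _ fun x hx => ?_)
    have h0 : 0 ≤ x ^ p := rpow_nonneg hx.1.le _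
    have h1 : (1 + x ^ p) ^ (-(3/2 : ℝ)) ≤ 1 :=
      rpow_le_one_of_one_le_of_nonpos (by linarith) (by norm_num)
    have h2 : 0 ≤ (1 + x ^ p) ^ (-(3/2 : ℝ)) := by positivity
    rw [norm_of_nonneg (mul_nonneg hx.1.le h2)]
    exact mul_le_one₀ hx.2 h2 h1
  · refine Integrable.mono' (integrableOn_Ioi_rpow_of_lt (a := 1 + p * (-(3/2))) (c := 1)
      (by linarith) one_pos) hm.aestronglyMeasurable ?_
    refine (ae_restrict_iff' measurableSet_Ioi).2 (ae_of_all _ fun x hx => ?_)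
    have hx0 : 0 < x := one_pos.trans hx
    have h0 : 0 < x ^ p := rpow_pos_of_pos hx0 _
    rw [norm_of_nonneg (by positivity), rpow_add hx0, rpow_one, rpow_mul hx0.le]
    exact mul_le_mul_of_nonneg_left
      (rpow_le_rpow_of_nonpos h0 (by linarith) (by norm_num)) hx0.le

lemma integral_kernel {p : ℝ} (hp : 0 < p) :
    ∫ x in Ioi 0, x * (1 + x ^ p) ^ (-(3/2 : ℝ)) = 1 / p * betaFn (2 / p) (3 / 2 - 2 / p) := by
  have hd : ∀ x ∈ Ioi (0:ℝ), HasDerivWithinAt (fun x : ℝ => 1 - (1 + x ^ p)⁻¹)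
      (p * x ^ (p - 1) / (1 + x ^ p) ^ 2) (Ioi 0) x := by
    intro x hx
    have h0 : 0 < x ^ p := rpow_pos_of_pos hx _
    have := (((Real.hasDerivAt_rpow_const (p := p) (Or.inl (ne_of_gt hx))).const_add 1).fun_inv
      (by positivity)).const_sub 1
    exact (this.congr_deriv (by rw [neg_div, neg_neg])).hasDerivWithinAt
  have hinj : InjOn (fun x : ℝ => 1 - (1 + x ^ p)⁻¹) (Ioi 0) := by
    intro x hx y hy h
    have h' : x ^ p = y ^ p := by simpa using h
    exact (rpow_left_inj (le_of_lt hx) (le_of_lt hy) hp.ne').1 h'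
  have himg : (fun x : ℝ => 1 - (1 + x ^ p)⁻¹) '' Ioi 0 = Ioo 0 1 := by
    ext z
    constructor
    · rintro ⟨x, hx, rfl⟩
      have h0 : 0 < x ^ p := rpow_pos_of_pos hx _
      have h1 : (1 + x ^ p)⁻¹ < 1 := inv_lt_one_of_one_lt₀ (by linarith)
      have h2 : 0 < (1 + x ^ p)⁻¹ := by positivity
      exact ⟨by simp only; linarith, by simp only; linarith⟩
    · rintro ⟨h0, h1⟩
      have h2 : 0 < 1 - z := by linarith
      refine ⟨(z / (1 - z)) ^ (p⁻¹), rpow_pos_of_pos (by positivity) _, ?_⟩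
      simp only
      rw [rpow_inv_rpow (by positivity) hp.ne']
      field_simp
      simp
  rw [betaFn, intervalIntegral.integral_of_le zero_le_one, integral_Ioc_eq_integral_Ioo, ← himg,
    integral_image_eq_integral_abs_deriv_smul measurableSet_Ioi hd hinj, ← integral_const_mul]
  refine setIntegral_congr_fun measurableSet_Ioi fun x hx => ?_
  have hx0 : (0:ℝ) < x := hx
  have h0 : 0 < x ^ p := rpow_pos_of_pos hx _
  have h1 : 0 < 1 + x ^ p := by positivity
  have e1 : 1 - (1 + x ^ p)⁻¹ = x ^ p * (1 + x ^ p)⁻¹ := by field_simp; ring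
  have e0 : p * x ^ (p - 1) / (1 + x ^ p) ^ 2 =
      p * x ^ (p - 1) * (1 + x ^ p) ^ (-((2:ℕ):ℝ)) := by
    rw [rpow_neg h1.le, rpow_natCast, div_eq_mul_inv]
  simp only [sub_sub_cancel, smul_eq_mul]
  rw [abs_of_pos (by positivity), e1, mul_rpow h0.le (by positivity), ← rpow_neg_one (1 + x ^ p),
    ← rpow_mul h1.le, ← rpow_mul h1.le, ← rpow_mul hx0.le, e0]
  have e2 : x = x ^ (p - 1) * x ^ (p * (2 / p - 1)) := by
    rw [← rpow_add hx0]
    conv_lhs => rw [← rpow_one x]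
    congr 1
    field_simp
    ring
  have e3 : (1 + x ^ p) ^ (-(3/2 : ℝ)) = (1 + x ^ p) ^ (-((2:ℕ):ℝ)) *
      ((1 + x ^ p) ^ (-1 * (2 / p - 1)) * (1 + x ^ p) ^ (-1 * (3 / 2 - 2 / p - 1))) := by
    rw [← rpow_add h1, ← rpow_add h1]
    congr 1
    push_cast
    ring
  calc x * (1 + x ^ p) ^ (-(3/2 : ℝ))
      = x ^ (p - 1) * x ^ (p * (2 / p - 1)) * (1 + x ^ p) ^ (-(3/2 : ℝ)) := by rw [← e2]
    _ = _ := by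
      rw [e3]
      field_simp

lemma betaFn_two {r : ℝ} (hr : 0 < r) : betaFn 2 r = 1 / (r * (r + 1)) := by
  have hc : ∫ x in (0:ℝ)..1, x ^ ((2:ℝ) - 1) * (1 - x) ^ (r - 1) =
      ∫ x in (0:ℝ)..1, (1 - x) * x ^ (r - 1) := by
    have := intervalIntegral.integral_comp_sub_left (a := 0) (b := 1)
      (fun x : ℝ => (1 - x) * x ^ (r - 1)) 1
    norm_num at this ⊢
    exact this
  have he : ∫ x in (0:ℝ)..1, (1 - x) * x ^ (r - 1) =
      ∫ x in (0:ℝ)..1, (x ^ (r - 1) - x ^ r) := by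
    rw [intervalIntegral.integral_of_le zero_le_one, intervalIntegral.integral_of_le zero_le_one]
    refine setIntegral_congr_fun measurableSet_Ioc fun x hx => ?_
    rw [sub_mul, one_mul, mul_comm, ← rpow_add_one hx.1.ne', sub_add_cancel]
  rw [betaFn, hc, he, intervalIntegral.integral_sub
      (intervalIntegral.intervalIntegrable_rpow' (by linarith))
      (intervalIntegral.intervalIntegrable_rpow' (by linarith)),
    integral_rpow (Or.inl (by linarith)), integral_rpow (Or.inl (by linarith))]
  rw [sub_add_cancel, zero_rpow hr.ne', zero_rpow (by linarith), one_rpow, one_rpow]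
  field_simp
  ring

lemma integral_integral_triangle_rpow {T r : ℝ} (hT : 0 < T) (hr : 0 < r) :
    ∫ s : ℝ, ∫ y : ℝ, {z : ℝ × ℝ | 0 ≤ z.1 ∧ 0 < z.2 ∧ z.1 + z.2 < T}.indicator
      (fun z => z.2 ^ (r - 1)) (s, y) = T ^ (r + 1) / (r * (r + 1)) := by
  have h1 : ∀ s : ℝ, ∫ y : ℝ, {z : ℝ × ℝ | 0 ≤ z.1 ∧ 0 < z.2 ∧ z.1 + z.2 < T}.indicator
      (fun z => z.2 ^ (r - 1)) (s, y) =
      (Ico 0 T).indicator (fun s => (T - s) ^ r / r) s := by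
    intro s
    by_cases hs : s ∈ Ico 0 T
    · have : ∀ y : ℝ, {z : ℝ × ℝ | 0 ≤ z.1 ∧ 0 < z.2 ∧ z.1 + z.2 < T}.indicator
          (fun z => z.2 ^ (r - 1)) (s, y) = (Ioo 0 (T - s)).indicator (fun y => y ^ (r - 1)) y := by
        intro y
        simp only [indicator, mem_ofPred_eq, mem_Ioo, hs.1, true_and, lt_sub_iff_add_lt']
      simp_rw [this]
      rw [integral_indicator measurableSet_Ioo, ← integral_Ioc_eq_integral_Ioo,
        ← intervalIntegral.integral_of_le (by linarith [hs.2]),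
        integral_rpow (Or.inl (by linarith)), indicator_of_mem hs, sub_add_cancel,
        zero_rpow hr.ne', sub_zero]
    · rw [indicator_of_notMem hs]
      have : ∀ y : ℝ, {z : ℝ × ℝ | 0 ≤ z.1 ∧ 0 < z.2 ∧ z.1 + z.2 < T}.indicator
          (fun z => z.2 ^ (r - 1)) (s, y) = 0 := by
        intro y
        refine indicator_of_notMem (fun h => hs ⟨h.1, ?_⟩) _
        have := h.2.1
        have := h.2.2
        simp only at *
        linarith
      simp [this]
  simp_rw [h1]
  rw [integral_indicator measurableSet_Ico, integral_Ico_eq_integral_Ioc,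
    ← intervalIntegral.integral_of_le hT.le,
    intervalIntegral.integral_comp_sub_left (fun x => x ^ r / r) T,
    intervalIntegral.integral_div, integral_rpow (Or.inl (by linarith)), sub_self, sub_zero,
    zero_rpow (by linarith)]
  field_simp
  ring

/-- The integrand of `V3one` after rescaling the two gaps. -/
noncomputable def rescaledIntegrand (p T c : ℝ) : ℝ × ℝ × ℝ × ℝ → ℝ :=
  {q | 0 ≤ q.1 ∧ 0 ≤ q.2.1 ∧ 0 ≤ q.2.2.1 ∧ 0 ≤ q.2.2.2 ∧
    q.1 + (c * q.2.2.1 + q.2.1 + c * q.2.2.2) ≤ T}.indicator fun q =>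
  (1 + q.2.2.1 ^ p) ^ (-(3/2 : ℝ)) * (1 + q.2.2.2 ^ p) ^ (-(3/2 : ℝ)) *
    ((c ^ 2)⁻¹ * (1/2 * ((q.2.1 + c * q.2.2.1 + c * q.2.2.2) ^ p - (q.2.1 + c * q.2.2.1) ^ p -
      (q.2.1 + c * q.2.2.2) ^ p + q.2.1 ^ p)))

/-- The pointwise limit of `rescaledIntegrand`. -/
noncomputable def limitIntegrand (p T : ℝ) (q : ℝ × ℝ × ℝ × ℝ) : ℝ :=
  p * (p - 1) / 2 * ({z : ℝ × ℝ | 0 ≤ z.1 ∧ 0 < z.2 ∧ z.1 + z.2 < T}.indicator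
    (fun z => z.2 ^ (p - 1 - 1)) (q.1, q.2.1) *
    ((Ioi 0).indicator (fun x : ℝ => x * (1 + x ^ p) ^ (-(3/2 : ℝ))) q.2.2.1 *
     (Ioi 0).indicator (fun x : ℝ => x * (1 + x ^ p) ^ (-(3/2 : ℝ))) q.2.2.2))

/-- An integrable majorant of `rescaledIntegrand`. -/
noncomputable def boundIntegrand (p T : ℝ) (q : ℝ × ℝ × ℝ × ℝ) : ℝ :=
  p * (p - 1) / 2 * ((Icc 0 T).indicator (fun _ => (1:ℝ)) q.1 *
    ((Ioc 0 T).indicator (fun y : ℝ => y ^ (p - 1 - 1)) q.2.1 *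
    ((Ioi 0).indicator (fun x : ℝ => x * (1 + x ^ p) ^ (-(3/2 : ℝ))) q.2.2.1 *
     (Ioi 0).indicator (fun x : ℝ => x * (1 + x ^ p) ^ (-(3/2 : ℝ))) q.2.2.2)))

lemma integrable_boundIntegrand {p T : ℝ} (hT : 0 < T) (hp : 4 / 3 < p) :
    Integrable (boundIntegrand p T) := by
  have hk := (integrable_indicator_iff measurableSet_Ioi).2 (integrable_kernel hp)
  have hy : Integrable ((Ioc 0 T).indicator (fun y : ℝ => y ^ (p - 1 - 1))) := by
    rw [integrable_indicator_iff measurableSet_Ioc,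
      ← intervalIntegrable_iff_integrableOn_Ioc_of_le hT.le]
    exact intervalIntegral.intervalIntegrable_rpow' (by linarith)
  have hs : Integrable ((Icc 0 T).indicator (fun _ : ℝ => (1:ℝ))) := by
    rw [integrable_indicator_iff measurableSet_Icc]
    exact integrableOn_const (by simp)
  exact (hs.mul_prod (hy.mul_prod (hk.mul_prod hk))).const_mul _

lemma measurable_rescaledIntegrand (p T c : ℝ) : Measurable (rescaledIntegrand p T c) := by
  refine Measurable.indicator (by fun_prop) ?_
  simp only [ofPred_and]
  repeat' apply MeasurableSet.inter
  all_goals exact measurableSet_le (by fun_prop) (by fun_prop)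

lemma rescaledIntegrand_eq {p T c : ℝ} (hc : 0 < c) {q : ℝ × ℝ × ℝ × ℝ}
    (hy : 0 < q.2.1) (ha : 0 < q.2.2.1) (hb : 0 < q.2.2.2) :
    ∃ η ∈ Icc q.2.1 (q.2.1 + c * q.2.2.1 + c * q.2.2.2),
      rescaledIntegrand p T c q =
      {q : ℝ × ℝ × ℝ × ℝ | 0 ≤ q.1 ∧ q.1 + (c * q.2.2.1 + q.2.1 + c * q.2.2.2) ≤ T}.indicator
        (fun q => p * (p - 1) / 2 * (η ^ (p - 1 - 1) *
          ((q.2.2.1 * (1 + q.2.2.1 ^ p) ^ (-(3/2 : ℝ))) *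
           (q.2.2.2 * (1 + q.2.2.2 ^ p) ^ (-(3/2 : ℝ)))))) q := by
  obtain ⟨η, hη, h⟩ := exists_second_difference_rpow (p := p) hy
    (mul_nonneg hc.le ha.le) (mul_nonneg hc.le hb.le)
  refine ⟨η, hη, ?_⟩
  simp only [rescaledIntegrand, indicator, mem_ofPred_eq, hy.le, ha.le, hb.le, true_and]
  split_ifs
  · rw [h, show p - 1 - 1 = p - 2 by ring]
    field_simp
  · rfl

lemma ae_gaps_ne_zero : ∀ᵐ q : ℝ × ℝ × ℝ × ℝ, q.2.1 ≠ 0 ∧ q.2.2.1 ≠ 0 ∧ q.2.2.2 ≠ 0 := by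
  have h2 : Measure.QuasiMeasurePreserving (fun q : ℝ × ℝ × ℝ × ℝ => q.2) volume volume :=
    Measure.quasiMeasurePreserving_snd
  have h3 : Measure.QuasiMeasurePreserving (fun q : ℝ × ℝ × ℝ => q.2) volume volume :=
    Measure.quasiMeasurePreserving_snd
  have g3 : Measure.QuasiMeasurePreserving (fun q : ℝ × ℝ × ℝ => q.1) volume volume :=
    Measure.quasiMeasurePreserving_fst
  have h4 : Measure.QuasiMeasurePreserving (fun q : ℝ × ℝ => q.2) volume volume :=
    Measure.quasiMeasurePreserving_snd
  have g4 : Measure.QuasiMeasurePreserving (fun q : ℝ × ℝ => q.1) volume volume :=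
    Measure.quasiMeasurePreserving_fst
  have h0 : ∀ᵐ x : ℝ, x ≠ 0 := Measure.ae_ne volume 0
  filter_upwards [(g3.comp h2).ae h0, (g4.comp (h3.comp h2)).ae h0, (h4.comp (h3.comp h2)).ae h0]
    with q a b c
  exact ⟨a, b, c⟩

lemma norm_rescaledIntegrand_le {p T c : ℝ} (hp : 4 / 3 < p) (hp2 : p < 2)
    (hc : 0 < c) {q : ℝ × ℝ × ℝ × ℝ} (hq : q.2.1 ≠ 0 ∧ q.2.2.1 ≠ 0 ∧ q.2.2.2 ≠ 0) :
    ‖rescaledIntegrand p T c q‖ ≤ boundIntegrand p T q := by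
  have hp0 : 0 ≤ p * (p - 1) / 2 := by nlinarith
  have hk := indicator_kernel_nonneg p
  have hbd : 0 ≤ boundIntegrand p T q :=
    mul_nonneg hp0 (mul_nonneg (indicator_nonneg (fun _ _ => zero_le_one) _)
      (mul_nonneg (indicator_nonneg (fun y hy => rpow_nonneg hy.1.le _) _)
        (mul_nonneg (hk _) (hk _))))
  by_cases hpos : 0 < q.2.1 ∧ 0 < q.2.2.1 ∧ 0 < q.2.2.2
  · obtain ⟨hy, ha, hb⟩ := hpos
    obtain ⟨η, hη, h⟩ := rescaledIntegrand_eq (p := p) (T := T) hc hy ha hb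
    rw [h]
    by_cases hq' : q ∈ {q : ℝ × ℝ × ℝ × ℝ | 0 ≤ q.1 ∧
        q.1 + (c * q.2.2.1 + q.2.1 + c * q.2.2.2) ≤ T}
    · rw [indicator_of_mem hq']
      have hca := mul_pos hc ha
      have hcb := mul_pos hc hb
      have hη0 : 0 < η := hy.trans_le hη.1
      have hs : q.1 ∈ Icc 0 T := ⟨hq'.1, by linarith [hq'.2]⟩
      have hyT : q.2.1 ∈ Ioc 0 T := ⟨hy, by linarith [hq'.2, hq'.1]⟩
      rw [norm_of_nonneg (mul_nonneg hp0 (by positivity)), boundIntegrand, indicator_of_mem hs,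
        indicator_of_mem hyT, indicator_of_mem (mem_Ioi.2 ha), indicator_of_mem (mem_Ioi.2 hb),
        one_mul]
      refine mul_le_mul_of_nonneg_left (mul_le_mul_of_nonneg_right ?_ (by positivity)) hp0
      exact rpow_le_rpow_of_nonpos hy hη.1 (by linarith)
    · rw [indicator_of_notMem hq', norm_zero]
      exact hbd
  · rw [rescaledIntegrand, indicator_of_notMem, norm_zero]
    · exact hbd
    · rintro ⟨-, hy, ha, hb, -⟩
      exact hpos ⟨hy.lt_of_ne' hq.1, ha.lt_of_ne' hq.2.1, hb.lt_of_ne' hq.2.2⟩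

lemma tendsto_rescaledIntegrand {p T : ℝ} {q : ℝ × ℝ × ℝ × ℝ}
    (hq : q.2.1 ≠ 0 ∧ q.2.2.1 ≠ 0 ∧ q.2.2.2 ≠ 0) :
    Tendsto (fun c => rescaledIntegrand p T c q) (nhdsWithin 0 (Ioi 0))
      (nhds (limitIntegrand p T q)) := by
  by_cases hpos : 0 < q.2.1 ∧ 0 < q.2.2.1 ∧ 0 < q.2.2.2
  · obtain ⟨hy, ha, hb⟩ := hpos
    by_cases hq' : 0 ≤ q.1 ∧ q.1 + q.2.1 < T
    · have hcont : Tendsto (fun c : ℝ => q.1 + (c * q.2.2.1 + q.2.1 + c * q.2.2.2))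
          (nhdsWithin 0 (Ioi 0)) (nhds (q.1 + q.2.1)) := by
        have : Continuous fun c : ℝ => q.1 + (c * q.2.2.1 + q.2.1 + c * q.2.2.2) := by fun_prop
        simpa using (this.tendsto 0).mono_left nhdsWithin_le_nhds
      have hη0 : Tendsto (fun c : ℝ => q.2.1 + c * q.2.2.1 + c * q.2.2.2)
          (nhdsWithin 0 (Ioi 0)) (nhds q.2.1) := by
        have : Continuous fun c : ℝ => q.2.1 + c * q.2.2.1 + c * q.2.2.2 := by fun_prop
        simpa using (this.tendsto 0).mono_left nhdsWithin_le_nhds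
      choose! η hη h using fun (c : ℝ) (hc : 0 < c) =>
        rescaledIntegrand_eq (p := p) (T := T) hc hy ha hb
      have hηt : Tendsto η (nhdsWithin 0 (Ioi 0)) (nhds q.2.1) :=
        tendsto_of_tendsto_of_tendsto_of_le_of_le' tendsto_const_nhds hη0
          (eventually_mem_nhdsWithin.mono fun c hc => (hη c hc).1)
          (eventually_mem_nhdsWithin.mono fun c hc => (hη c hc).2)
      rw [limitIntegrand, indicator_of_mem (show (q.1, q.2.1) ∈
        {z : ℝ × ℝ | 0 ≤ z.1 ∧ 0 < z.2 ∧ z.1 + z.2 < T} from ⟨hq'.1, hy, hq'.2⟩),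
        indicator_of_mem (mem_Ioi.2 ha), indicator_of_mem (mem_Ioi.2 hb)]
      refine (((hηt.rpow_const (p := p - 1 - 1) (Or.inl hy.ne')).mul_const _).const_mul
        (p * (p - 1) / 2)).congr' ?_
      filter_upwards [eventually_mem_nhdsWithin, hcont.eventually_le_const hq'.2] with c hc hcT
      rw [h c hc, indicator_of_mem]
      exact ⟨hq'.1, hcT⟩
    · rw [limitIntegrand, indicator_of_notMem (fun h => hq' ⟨h.1, h.2.2⟩), zero_mul, mul_zero]
      refine tendsto_const_nhds.congr' ?_
      filter_upwards [eventually_mem_nhdsWithin] with c hc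
      rw [rescaledIntegrand, indicator_of_notMem]
      rintro ⟨h1, -, -, -, h2⟩
      have hca := mul_pos (mem_Ioi.1 hc) ha
      have hcb := mul_pos (mem_Ioi.1 hc) hb
      exact hq' ⟨h1, by linarith⟩
  · have h0 : limitIntegrand p T q = 0 := by
      by_contra hne
      simp only [limitIntegrand, mul_eq_zero, indicator_apply_eq_zero, not_or, not_forall] at hne
      obtain ⟨-, ⟨h1, -⟩, ⟨h2, -⟩, ⟨h3, -⟩⟩ := hne
      exact hpos ⟨h1.2.1, h2, h3⟩
    rw [h0]
    refine tendsto_const_nhds.congr fun c => ?_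
    rw [rescaledIntegrand, indicator_of_notMem]
    rintro ⟨-, hy, ha, hb, -⟩
    exact hpos ⟨hy.lt_of_ne' hq.1, ha.lt_of_ne' hq.2.1, hb.lt_of_ne' hq.2.2⟩

lemma integrable_limitIntegrand {p T : ℝ} (hT : 0 < T) (hp : 4 / 3 < p) :
    Integrable (limitIntegrand p T) := by
  have hp0 : 0 ≤ p * (p - 1) / 2 := by nlinarith
  have hk := indicator_kernel_nonneg p
  have hS : MeasurableSet {z : ℝ × ℝ | 0 ≤ z.1 ∧ 0 < z.2 ∧ z.1 + z.2 < T} := by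
    simp only [ofPred_and]
    exact (measurableSet_le (by fun_prop) (by fun_prop)).inter
      ((measurableSet_lt (by fun_prop) (by fun_prop)).inter
        (measurableSet_lt (by fun_prop) (by fun_prop)))
  have hkm : Measurable ((Ioi 0).indicator (fun x : ℝ => x * (1 + x ^ p) ^ (-(3/2 : ℝ)))) :=
    Measurable.indicator (by fun_prop) measurableSet_Ioi
  have hhm : Measurable ({z : ℝ × ℝ | 0 ≤ z.1 ∧ 0 < z.2 ∧ z.1 + z.2 < T}.indicator
      (fun z : ℝ × ℝ => z.2 ^ (p - 1 - 1))) := Measurable.indicator (by fun_prop) hS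
  have hm : Measurable (limitIntegrand p T) := by
    unfold limitIntegrand
    exact ((hhm.comp (by fun_prop : Measurable fun q : ℝ × ℝ × ℝ × ℝ => (q.1, q.2.1))).mul
      ((hkm.comp (by fun_prop)).mul (hkm.comp (by fun_prop)))).const_mul _
  refine (integrable_boundIntegrand hT hp).mono' hm.aestronglyMeasurable (ae_of_all _ fun q => ?_)
  have hz : ∀ z ∈ {z : ℝ × ℝ | 0 ≤ z.1 ∧ 0 < z.2 ∧ z.1 + z.2 < T}, 0 ≤ z.2 ^ (p - 1 - 1) :=
    fun z hz => rpow_nonneg hz.2.1.le _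
  rw [limitIntegrand, boundIntegrand, norm_of_nonneg (mul_nonneg hp0 (mul_nonneg
    (indicator_nonneg hz _) (mul_nonneg (hk _) (hk _)))), ← mul_assoc (indicator _ _ q.1)]
  refine mul_le_mul_of_nonneg_left (mul_le_mul_of_nonneg_right ?_ (mul_nonneg (hk _) (hk _))) hp0
  by_cases h : (q.1, q.2.1) ∈ {z : ℝ × ℝ | 0 ≤ z.1 ∧ 0 < z.2 ∧ z.1 + z.2 < T}
  · have h' := h
    obtain ⟨h1, h2, h3⟩ := h'
    simp only at h1 h2 h3
    rw [indicator_of_mem h, indicator_of_mem (show q.1 ∈ Icc 0 T from ⟨h1, by linarith⟩),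
      indicator_of_mem (show q.2.1 ∈ Ioc 0 T from ⟨h2, by linarith⟩), one_mul]
  · rw [indicator_of_notMem h]
    exact mul_nonneg (indicator_nonneg (fun _ _ => zero_le_one) _)
      (indicator_nonneg (fun y hy => rpow_nonneg hy.1.le _) _)

lemma integral_limitIntegrand {p T : ℝ} (hT : 0 < T) (hp : 4 / 3 < p) :
    ∫ q, limitIntegrand p T q =
      T ^ p / 2 * (1 / p * betaFn (2 / p) (3 / 2 - 2 / p)) ^ 2 := by
  rw [Measure.volume_eq_prod, integral_prod _ (integrable_limitIntegrand hT hp)]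
  have h1 : ∀ s : ℝ, ∫ r : ℝ × ℝ × ℝ, limitIntegrand p T (s, r) =
      p * (p - 1) / 2 * ((∫ y : ℝ, {z : ℝ × ℝ | 0 ≤ z.1 ∧ 0 < z.2 ∧ z.1 + z.2 < T}.indicator
        (fun z => z.2 ^ (p - 1 - 1)) (s, y)) *
        (1 / p * betaFn (2 / p) (3 / 2 - 2 / p)) ^ 2) := by
    intro s
    simp only [limitIntegrand]
    rw [integral_const_mul, Measure.volume_eq_prod, integral_prod_mul
      (fun y : ℝ => {z : ℝ × ℝ | 0 ≤ z.1 ∧ 0 < z.2 ∧ z.1 + z.2 < T}.indicator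
        (fun z => z.2 ^ (p - 1 - 1)) (s, y))
      (fun w : ℝ × ℝ =>
        (Ioi 0).indicator (fun x : ℝ => x * (1 + x ^ p) ^ (-(3/2 : ℝ))) w.1 *
        (Ioi 0).indicator (fun x : ℝ => x * (1 + x ^ p) ^ (-(3/2 : ℝ))) w.2),
      Measure.volume_eq_prod, integral_prod_mul, integral_indicator measurableSet_Ioi,
      integral_kernel (by linarith), sq]
  simp_rw [h1]
  rw [integral_const_mul, integral_mul_const,
    integral_integral_triangle_rpow hT (by linarith), sub_add_cancel]
  have : p - 1 ≠ 0 := by linarith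
  field_simp

lemma tendsto_integral_rescaledIntegrand {p T : ℝ} (hT : 0 < T) (hp : 4 / 3 < p) (hp2 : p < 2) :
    Tendsto (fun c => ∫ q, rescaledIntegrand p T c q) (nhdsWithin 0 (Ioi 0))
      (nhds (T ^ p / 2 * (1 / p * betaFn (2 / p) (3 / 2 - 2 / p)) ^ 2)) := by
  rw [← integral_limitIntegrand hT hp]
  refine tendsto_integral_filter_of_dominated_convergence (boundIntegrand p T)
    (Eventually.of_forall fun c => (measurable_rescaledIntegrand p T c).aestronglyMeasurable)
    ?_ (integrable_boundIntegrand hT hp)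
    (ae_gaps_ne_zero.mono fun q hq => tendsto_rescaledIntegrand hq)
  filter_upwards [eventually_mem_nhdsWithin] with c hc
  exact ae_gaps_ne_zero.mono fun q hq => norm_rescaledIntegrand_le hp hp2 hc hq

lemma measurableSet_regS3 (T : ℝ) : MeasurableSet (regS3 T) := by
  have h : IsClosed (regS3 T) := by
    simp only [regS3, mem_Icc, ofPred_and]
    repeat' apply IsClosed.inter
    all_goals exact isClosed_le (by fun_prop) (by fun_prop)
  exact h.measurableSet

lemma rpow_mul_V3one {T H ε : ℝ} (hH : 0 < H) (hε : 0 < ε) :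
    ε ^ (3 - 2/H) * V3one H T ε =
      1 / π * ∫ q, rescaledIntegrand (2 * H) T (ε ^ (1 / (2 * H))) q := by
  set c := ε ^ (1 / (2 * H)) with hcdef
  have hc : 0 < c := rpow_pos_of_pos hε _
  have hcp : c ^ (2 * H) = ε := by
    rw [hcdef, ← rpow_mul hε.le, one_div_mul_cancel (by positivity), rpow_one]
  have hc4 : ε ^ (3 - 2 / H) * c ^ 2 * (ε ^ (-(3/2 : ℝ)) * ε ^ (-(3/2 : ℝ))) = (c ^ 2)⁻¹ := by
    rw [hcdef, ← rpow_natCast, ← rpow_mul hε.le, ← rpow_neg hε.le, ← rpow_add hε, ← rpow_add hε,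
      ← rpow_add hε]
    congr 1
    push_cast
    field_simp
    ring
  rw [V3one, ← integral_indicator (measurableSet_regS3 T), integral_gaps hc, mul_left_comm,
    ← mul_assoc (ε ^ _), ← integral_const_mul]
  congr 1
  refine integral_congr_ae (ae_of_all _ ?_)
  rintro ⟨s, y, a, b⟩
  simp only [rescaledIntegrand, indicator, mem_ofPred_eq, mul_ite, mul_zero]
  have hiff : ((s, s + (c * a + y), s + c * a, s + (c * a + y + c * b)) ∈ regS3 T) ↔
      (0 ≤ s ∧ 0 ≤ y ∧ 0 ≤ a ∧ 0 ≤ b ∧ s + (c * a + y + c * b) ≤ T) := by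
    simp only [regS3, mem_ofPred_eq, mem_Icc]
    constructor
    · rintro ⟨h1, h2, h3, h4, h5, h6, h7⟩
      exact ⟨h1.1, by linarith, nonneg_of_mul_nonneg_right (by linarith : 0 ≤ c * a) hc,
        nonneg_of_mul_nonneg_right (by linarith : 0 ≤ c * b) hc, h4.2⟩
    · rintro ⟨h1, h2, h3, h4, h5⟩
      have := mul_nonneg hc.le h3
      have := mul_nonneg hc.le h4
      refine ⟨⟨?_, ?_⟩, ⟨?_, ?_⟩, ⟨?_, ?_⟩, ⟨?_, ?_⟩, ?_, ?_, ?_⟩ <;> linarith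
  simp only [hiff]
  split_ifs with h
  · obtain ⟨h1, h2, h3, h4, h5⟩ := h
    have hk : ∀ x : ℝ, 0 ≤ x → (ε + (c * x) ^ (2 * H)) ^ (-(3/2 : ℝ)) =
        ε ^ (-(3/2 : ℝ)) * (1 + x ^ (2 * H)) ^ (-(3/2 : ℝ)) := by
      intro x hx
      have := rpow_nonneg hx (2 * H)
      rw [mul_rpow hc.le hx, hcp, ← mul_rpow hε.le (by positivity)]
      ring_nf
    have hca := mul_nonneg hc.le h3
    have hcb := mul_nonneg hc.le h4
    rw [show s + c * a - s = c * a by ring,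
      show s + (c * a + y + c * b) - (s + (c * a + y)) = c * b by ring,
      show s + (c * a + y) - s = y + c * a by ring, hk a h3, hk b h4, mu,
      show y + c * a + c * b - c * a = y + c * b by ring,
      show y + c * a - c * a = y by ring, abs_of_nonneg h2, abs_of_nonneg (by positivity), ← hc4]
    ring
  · rfl

/-- For `2/3 < H < 1`, `ε^{3 - 2/H} V₃⁽¹⁾(ε) → σ²` as `ε → 0⁺`, where
`σ² = T^{2H}(2H-1)/(4Hπ) · B(1/H, (3H-2)/(2H))² · B(2, 2H-1)`. -/
theorem tendsto_V3one (T : ℝ) (hT : 0 < T) (H : ℝ) (hH : H ∈ Ioo (2/3 : ℝ) 1) :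
    Tendsto (fun ε : ℝ => ε ^ (3 - 2/H) * V3one H T ε) (nhdsWithin 0 (Ioi 0))
      (nhds (T ^ (2*H) * (2*H - 1) / (4*H*π) *
        betaFn (1/H) ((3*H - 2) / (2*H)) ^ 2 * betaFn 2 (2*H - 1))) := by
  obtain ⟨h1, h2⟩ := hH
  have hH0 : 0 < H := by linarith
  have hc : Tendsto (fun ε : ℝ => ε ^ (1 / (2 * H))) (nhdsWithin 0 (Ioi 0))
      (nhdsWithin 0 (Ioi 0)) := by
    refine tendsto_nhdsWithin_iff.2 ⟨?_, eventually_mem_nhdsWithin.mono fun ε hε =>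
      rpow_pos_of_pos hε _⟩
    have := (continuousAt_rpow_const 0 (1 / (2 * H)) (Or.inr (by positivity))).tendsto
    rw [zero_rpow (by positivity)] at this
    exact this.mono_left nhdsWithin_le_nhds
  have h := ((tendsto_integral_rescaledIntegrand (p := 2 * H) hT (by linarith)
    (by linarith)).comp hc).const_mul (1 / π)
  have hval : T ^ (2*H) * (2*H - 1) / (4*H*π) *
      betaFn (1/H) ((3*H - 2) / (2*H)) ^ 2 * betaFn 2 (2*H - 1) =
      1 / π * (T ^ (2*H) / 2 *
        (1 / (2*H) * betaFn (2 / (2*H)) (3 / 2 - 2 / (2*H))) ^ 2) := by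
    rw [betaFn_two (by linarith), show 2 / (2*H) = 1 / H by field_simp,
      show 3 / 2 - 1 / H = (3*H - 2) / (2*H) by field_simp]
    have : 2 * H - 1 ≠ 0 := by linarith
    rw [sub_add_cancel]
    field_simp
    ring
  rw [hval]
  refine h.congr' ?_
  filter_upwards [eventually_mem_nhdsWithin] with ε hε
  exact (rpow_mul_V3one hH0 hε).symm
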